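/- arXiv:1610.09745 — 2 statements merged into one kernel-verified Lean document; each statement's English description precedes it below -/
import Mathlib

section
/- Let n ≥ 2 and M ≥ 1 be integers. If h : V → ℝ is the hitting-time solution for the target vertex b = (2,…,2) of the Hamming-graph walk, and g : {0,1,…,M} → ℝ is the birth–death hitting-time solution, then h((1,…,1)) = g(0). -/
open Finset

/-- `h` is the hitting-time solution for target `b` of the symmetric nearest-neighbor
random walk on the Hamming graph `{1,…,n}^M` (vertices differ in exactly one coordinate). -/
def IsHitSol {M n : ℕ} (b : Fin M → Fin n) (h : (Fin M → Fin n) → ℝ) : Prop :=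
  h b = 0 ∧ ∀ x, x ≠ b →
    h x = 1 + (1 / (((n : ℝ) - 1) * M)) *
      ∑ y ∈ univ.filter (fun y => hammingDist x y = 1), h y

/-- `g` is the birth–death hitting-time solution for the chain on `{0,…,M}` with
transition probabilities `p_{j,j-1} = j/M`, `p_{j,j} = (n-2)(M-j)/((n-1)M)`,
`p_{j,j+1} = (M-j)/((n-1)M)`, target state `M`.  (When `j = 0` the coefficient
`j/M` vanishes, so the `g (j-1)` term is absent.) -/
def IsBDSol (n M : ℕ) (g : ℕ → ℝ) : Prop :=
  g M = 0 ∧ ∀ j < M,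
    g j = 1 + ((j : ℝ) / M) * g (j - 1) +
      (((n : ℝ) - 2) * ((M : ℝ) - j) / (((n : ℝ) - 1) * M)) * g j +
      (((M : ℝ) - j) / (((n : ℝ) - 1) * M)) * g (j + 1)

section Agreement

variable {ι α : Type*} [Fintype ι] [DecidableEq α]

/-- The set of coordinates on which `x` agrees with `b`. -/
def agreement (b x : ι → α) : Finset ι := univ.filter (fun i => x i = b i)

theorem card_agreement_lt {b x : ι → α} (hx : x ≠ b) :
    #(agreement b x) < Fintype.card ι := by
  obtain ⟨i, hi⟩ := Function.ne_iff.1 hx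
  exact card_lt_univ_of_notMem (x := i) (by simpa [agreement] using hi)

variable [DecidableEq ι]

theorem agreement_update_eq (b x : ι → α) (i : ι) :
    agreement b (Function.update x i (b i)) = insert i (agreement b x) := by
  ext k
  by_cases hk : k = i
  · subst hk; simp [agreement]
  · simp [agreement, hk]

theorem agreement_update_ne (b x : ι → α) {i : ι} {a : α} (ha : a ≠ b i) :
    agreement b (Function.update x i a) = (agreement b x).erase i := by
  ext k
  by_cases hk : k = i
  · subst hk; simp [agreement, ha]
  · simp [agreement, hk]

end Agreement

section Hamming

variable {ι α : Type*} [Fintype ι] [DecidableEq ι] [Fintype α] [DecidableEq α]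

/-- A sum over the Hamming neighbors of `x` is a sum over the changed coordinate and
its new value. -/
theorem sum_hammingDist_eq_one (x : ι → α) (f : (ι → α) → ℝ) :
    ∑ y ∈ univ.filter (fun y => hammingDist x y = 1), f y =
      ∑ i, ∑ a ∈ univ.erase (x i), f (Function.update x i a) := by
  rw [Finset.sum_sigma']
  symm
  refine Finset.sum_bij (fun p _ => Function.update x p.1 p.2) ?_ ?_ ?_ ?_
  · rintro ⟨i, a⟩ hp
    have ha : a ≠ x i := by simpa using hp
    simp only [mem_filter, mem_univ, true_and, hammingDist, card_eq_one]
    refine ⟨i, ?_⟩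
    ext k
    by_cases hk : k = i
    · subst hk; simpa using ha.symm
    · simp [hk]
  · rintro ⟨i, a⟩ hp ⟨k, c⟩ hq heq
    have ha : a ≠ x i := by simpa using hp
    simp only at heq
    have hi := congrFun heq i
    rw [Function.update_self] at hi
    by_cases hk : i = k
    · subst hk
      rw [Function.update_self] at hi
      rw [hi]
    · rw [Function.update_of_ne hk] at hi
      exact absurd hi ha
  · intro y hy
    simp only [mem_filter, mem_univ, true_and, hammingDist, card_eq_one] at hy
    obtain ⟨i, hi⟩ := hy
    have hmem : ∀ k, x k ≠ y k ↔ k = i := fun k => by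
      simpa using Finset.ext_iff.1 hi k
    refine ⟨⟨i, y i⟩, by simpa using ((hmem i).2 rfl).symm, ?_⟩
    ext k
    by_cases hk : k = i
    · subst hk; simp
    · simpa [hk] using not_not.1 (mt (hmem k).1 hk)
  · intros; rfl

/-- The neighbor sum of a function of the number of coordinates agreeing with `b`. -/
theorem sum_neighbors_card_agreement (b x : ι → α) (g : ℕ → ℝ) :
    ∑ y ∈ univ.filter (fun y => hammingDist x y = 1), g #(agreement b y) =
      #(agreement b x) * (((Fintype.card α : ℝ) - 1) * g (#(agreement b x) - 1)) +
      ((Fintype.card ι : ℝ) - #(agreement b x)) *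
        (g (#(agreement b x) + 1) + ((Fintype.card α : ℝ) - 2) * g #(agreement b x)) := by
  rw [sum_hammingDist_eq_one]
  have hin : ∀ i ∈ agreement b x,
      ∑ a ∈ univ.erase (x i), g #(agreement b (Function.update x i a)) =
        ((Fintype.card α : ℝ) - 1) * g (#(agreement b x) - 1) := by
    intro i hi
    have hxi : x i = b i := by simpa [agreement] using hi
    rw [Finset.sum_congr rfl (g := fun _ => g (#(agreement b x) - 1)), sum_const,
      nsmul_eq_mul, cast_card_erase_of_mem (mem_univ _), card_univ]
    intro a ha
    rw [agreement_update_ne b x (by simpa [hxi] using ha), card_erase_of_mem hi]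
  have hout : ∀ i ∈ (agreement b x)ᶜ,
      ∑ a ∈ univ.erase (x i), g #(agreement b (Function.update x i a)) =
        g (#(agreement b x) + 1) + ((Fintype.card α : ℝ) - 2) * g #(agreement b x) := by
    intro i hi
    have hi' : i ∉ agreement b x := by simpa using hi
    have hxi : b i ≠ x i := fun e => hi' (by simp [agreement, e])
    have hb : b i ∈ univ.erase (x i) := by simpa using hxi
    rw [← add_sum_erase _ _ hb, agreement_update_eq, card_insert_of_notMem hi',
      Finset.sum_congr rfl (g := fun _ => g #(agreement b x)), sum_const, nsmul_eq_mul,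
      cast_card_erase_of_mem hb, cast_card_erase_of_mem (mem_univ _), card_univ]
    · ring
    · intro a ha
      rw [agreement_update_ne b x (mem_erase.1 ha).1, erase_eq_of_notMem hi']
  rw [← sum_add_sum_compl (agreement b x), Finset.sum_congr rfl hin, Finset.sum_congr rfl hout,
    sum_const, sum_const, nsmul_eq_mul, nsmul_eq_mul, card_compl,
    Nat.cast_sub (card_le_univ _)]

theorem card_hammingDist_eq_one (x : ι → α) :
    (#(univ.filter (fun y => hammingDist x y = 1)) : ℝ) =
      ((Fintype.card α : ℝ) - 1) * Fintype.card ι := by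
  have := sum_neighbors_card_agreement x x (fun _ => 1)
  simp only [sum_const, nsmul_eq_mul, mul_one] at this
  rw [this]
  ring

/-- Maximum principle: a function dominated by its neighbor average away from `b` is
bounded by its value at `b`. -/
theorem le_of_subharmonic_off (b : ι → α) (d : (ι → α) → ℝ)
    (hd : ∀ x, x ≠ b → (#(univ.filter (fun y => hammingDist x y = 1)) : ℝ) * d x ≤
      ∑ y ∈ univ.filter (fun y => hammingDist x y = 1), d y) (x : ι → α) :
    d x ≤ d b := by
  obtain ⟨m, -, hm⟩ := exists_max_image univ d ⟨b, mem_univ b⟩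
  obtain ⟨z, hz, hzmax⟩ := exists_max_image (univ.filter (fun z => d z = d m))
    (fun z => #(agreement b z)) ⟨m, by simp⟩
  have hzm : d z = d m := by simpa using hz
  suffices hzb : z = b by
    rw [← hzb, hzm]
    exact hm x (mem_univ x)
  by_contra hne
  obtain ⟨i, hi⟩ := Function.ne_iff.1 hne
  have hnbr : hammingDist z (Function.update z i (b i)) = 1 := by
    rw [hammingDist, card_eq_one]
    refine ⟨i, ?_⟩
    ext k
    by_cases hk : k = i
    · subst hk; simpa using hi
    · simp [hk]
  have heq : d (Function.update z i (b i)) = d m := by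
    refine le_antisymm (hm _ (mem_univ _)) (not_lt.1 fun hlt => ?_)
    have := sum_lt_sum (s := univ.filter (fun y => hammingDist z y = 1)) (f := d)
      (g := fun _ => d m) (fun y _ => hm y (mem_univ y)) ⟨_, by simpa using hnbr, hlt⟩
    have hz' := hd z hne
    rw [sum_const, nsmul_eq_mul] at this
    rw [hzm] at hz'
    linarith
  have hcard := hzmax _ (mem_filter.2 ⟨mem_univ _, heq⟩)
  rw [agreement_update_eq, card_insert_of_notMem (by simpa [agreement] using hi)] at hcard
  omega

end Hamming

theorem IsHitSol.card_mul {M n : ℕ} (hn : 2 ≤ n) (hM : 1 ≤ M) {b : Fin M → Fin n}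
    {h : (Fin M → Fin n) → ℝ} (hh : IsHitSol b h) {x : Fin M → Fin n} (hx : x ≠ b) :
    (#(univ.filter (fun y => hammingDist x y = 1)) : ℝ) * h x =
      ((n : ℝ) - 1) * M + ∑ y ∈ univ.filter (fun y => hammingDist x y = 1), h y := by
  have hn' : (2 : ℝ) ≤ n := by exact_mod_cast hn
  have hn1 : (n : ℝ) - 1 ≠ 0 := by linarith
  have hM0 : (M : ℝ) ≠ 0 := by exact_mod_cast (by omega : M ≠ 0)
  rw [card_hammingDist_eq_one, Fintype.card_fin, Fintype.card_fin, hh.2 x hx]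
  field_simp

theorem IsHitSol.unique {M n : ℕ} (hn : 2 ≤ n) (hM : 1 ≤ M) {b : Fin M → Fin n}
    {h k : (Fin M → Fin n) → ℝ} (hh : IsHitSol b h) (hk : IsHitSol b k) : h = k := by
  have hle : ∀ {h k : (Fin M → Fin n) → ℝ}, IsHitSol b h → IsHitSol b k → ∀ x, h x ≤ k x := by
    intro h k hh hk x
    have := le_of_subharmonic_off b (fun y => h y - k y) (fun y hy => by
      rw [mul_sub, sum_sub_distrib, hh.card_mul hn hM hy, hk.card_mul hn hM hy]
      linarith) x
    rw [hh.1, hk.1] at this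
    linarith
  exact funext fun x => le_antisymm (hle hh hk x) (hle hk hh x)

/-- The birth–death solution, evaluated at the number of agreements with `b`, solves the
hitting-time equations on the Hamming graph. -/
theorem IsBDSol.isHitSol {n M : ℕ} (hn : 2 ≤ n) (hM : 1 ≤ M) {g : ℕ → ℝ}
    (hg : IsBDSol n M g) (b : Fin M → Fin n) :
    IsHitSol b (fun x => g #(agreement b x)) := by
  have hn' : (2 : ℝ) ≤ n := by exact_mod_cast hn
  have hn1 : (n : ℝ) - 1 ≠ 0 := by linarith
  have hM0 : (M : ℝ) ≠ 0 := by exact_mod_cast (by omega : M ≠ 0)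
  refine ⟨by simpa [agreement] using hg.1, fun x hx => ?_⟩
  have hlt : #(agreement b x) < M := by simpa using card_agreement_lt hx
  simp only
  rw [sum_neighbors_card_agreement, Fintype.card_fin, Fintype.card_fin]
  refine (hg.2 _ hlt).trans ?_
  field_simp
  ring

theorem stmt_3 (n M : ℕ) (hn : 2 ≤ n) (hM : 1 ≤ M)
    (h : (Fin M → Fin n) → ℝ)
    (hsol : IsHitSol (fun _ => (⟨1, by omega⟩ : Fin n)) h)
    (g : ℕ → ℝ) (hg : IsBDSol n M g) :
    h (fun _ => (⟨0, by omega⟩ : Fin n)) = g 0 := by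
  rw [hsol.unique hn hM (hg.isHitSol hn hM _)]
  simp [agreement]
end

section
/- Let n ≥ 2 and k ≥ 2 be integers. If u : {1,…,2k} → ℝ is a harmonic solution for the lumped chain, then for every i = 1,…,k−1, u(1) = (i/k)·u(2i) + ((k−i)/k)·u(2i+1), where u(2k−1) = 0 is used when i = k−1. -/
/-- Transition probabilities of the lumped chain on the states `{1,…,2k}`:
for `1 ≤ i ≤ k`,
`q(2i,2i−1) = 1/k`, `q(2i,2i−2) = (i−1)/k`, `q(2i,2i+2) = (k−i)/(k(n−1))`,
`q(2i,2i) = (k−i)(n−2)/(k(n−1))`, `q(2i−1,2i) = 1/(k(n−1))`,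
`q(2i−1,2i+1) = (k−i)/(k(n−1))`, `q(2i−1,2i−3) = (i−1)/k`,
`q(2i−1,2i−1) = (k−i+1)(n−2)/(k(n−1))`, and `q(m,m′) = 0` otherwise. -/
noncomputable def lumpedQ (n k : ℕ) (m m' : ℕ) : ℝ :=
  if m % 2 = 0 then
    let i := m / 2
    if m' = 2 * i - 1 then 1 / (k : ℝ)
    else if m' = 2 * i - 2 then ((i : ℝ) - 1) / (k : ℝ)
    else if m' = 2 * i + 2 then ((k : ℝ) - (i : ℝ)) / ((k : ℝ) * ((n : ℝ) - 1))
    else if m' = 2 * i then ((k : ℝ) - (i : ℝ)) * ((n : ℝ) - 2) / ((k : ℝ) * ((n : ℝ) - 1))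
    else 0
  else
    let i := (m + 1) / 2
    if m' = 2 * i then 1 / ((k : ℝ) * ((n : ℝ) - 1))
    else if m' = 2 * i + 1 then ((k : ℝ) - (i : ℝ)) / ((k : ℝ) * ((n : ℝ) - 1))
    else if m' = 2 * i - 3 then ((i : ℝ) - 1) / (k : ℝ)
    else if m' = 2 * i - 1 then
      ((k : ℝ) - (i : ℝ) + 1) * ((n : ℝ) - 2) / ((k : ℝ) * ((n : ℝ) - 1))
    else 0

/-- `u` is a harmonic solution for the lumped chain: `u(2k−1) = 0`, `u(2k) = 1`, and
`u(m) = ∑_{m'=1}^{2k} q(m,m')·u(m')` for every `1 ≤ m ≤ 2k−2`; `u(m)` is the probability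
of hitting state `2k` before state `2k−1` starting from `m`. -/
def IsHarmonicSol (n k : ℕ) (u : ℕ → ℝ) : Prop :=
  u (2 * k - 1) = 0 ∧ u (2 * k) = 1 ∧
    ∀ m, 1 ≤ m → m ≤ 2 * k - 2 →
      u m = ∑ m' ∈ Finset.Icc 1 (2 * k), lumpedQ n k m m' * u m'

/-- Summing against a function supported on four distinct points. -/
lemma sum_mul_eq_of_support_four {s : Finset ℕ} {q u : ℕ → ℝ} {a b c d : ℕ}
    (hab : a ≠ b) (hac : a ≠ c) (had : a ≠ d) (hbc : b ≠ c) (hbd : b ≠ d) (hcd : c ≠ d)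
    (ha : a ∈ s) (hb : b ∈ s ∨ q b = 0) (hc : c ∈ s) (hd : d ∈ s)
    (hq : ∀ m ∈ s, m ≠ a → m ≠ b → m ≠ c → m ≠ d → q m = 0) :
    ∑ m ∈ s, q m * u m = q a * u a + q b * u b + q c * u c + q d * u d := by
  have hsum : ∑ m ∈ s, q m * u m = ∑ m ∈ s, ((if m = a then q a * u a else 0) +
      (if m = b then q b * u b else 0) + (if m = c then q c * u c else 0) +
      (if m = d then q d * u d else 0)) := by
    refine Finset.sum_congr rfl fun m hm => ?_
    have := hq m hm
    grind
  rw [hsum]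
  simp only [Finset.sum_add_distrib, Finset.sum_ite_eq', if_pos ha, if_pos hc, if_pos hd]
  rcases hb with hb | hb <;> simp [hb]

/-- The harmonic equation at an even state, cleared of denominators. -/
lemma IsHarmonicSol.even_eq {n k : ℕ} (hn : 2 ≤ n) {u : ℕ → ℝ} (hu : IsHarmonicSol n k u)
    {i : ℕ} (hi : 1 ≤ i) (hik : i < k) :
    (k : ℝ) * (n - 1) * u (2 * i) = (n - 1) * u (2 * i - 1) + (i - 1) * (n - 1) * u (2 * i - 2) +
      (k - i) * u (2 * i + 2) + (k - i) * (n - 2) * u (2 * i) := by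
  have hk0 : (k : ℝ) ≠ 0 := by norm_cast; omega
  have hn0 : (n : ℝ) - 1 ≠ 0 := by
    have : (2 : ℝ) ≤ n := by exact_mod_cast hn
    linarith
  have h1 : lumpedQ n k (2 * i) (2 * i - 1) = 1 / k := by simp [lumpedQ]
  have h2 : lumpedQ n k (2 * i) (2 * i - 2) = (i - 1) / k := by
    simp [lumpedQ, show 2 * i - 2 ≠ 2 * i - 1 by omega]
  have h3 : lumpedQ n k (2 * i) (2 * i + 2) = (k - i) / (k * (n - 1)) := by
    simp [lumpedQ, show 2 * i + 2 ≠ 2 * i - 1 by omega, show 2 * i + 2 ≠ 2 * i - 2 by omega]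
  have h4 : lumpedQ n k (2 * i) (2 * i) = (k - i) * (n - 2) / (k * (n - 1)) := by
    simp [lumpedQ, show 2 * i ≠ 2 * i - 1 by omega, show 2 * i ≠ 2 * i - 2 by omega]
  have h := hu.2.2 (2 * i) (by omega) (by omega)
  rw [sum_mul_eq_of_support_four (a := 2 * i - 1) (b := 2 * i - 2) (c := 2 * i + 2) (d := 2 * i)
    (by omega) (by omega) (by omega) (by omega) (by omega) (by omega)
    (by simp; omega) ?_ (by simp; omega) (by simp; omega) ?_, h1, h2, h3, h4] at h
  · field_simp at h
    linarith
  · rcases hi.eq_or_lt with rfl | hi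
    · right; rw [h2]; simp
    · left; simp; omega
  · intro m _ ha hb hc hd
    simp [lumpedQ, ha, hb, hc, hd]

/-- The harmonic equation at an odd state, cleared of denominators. -/
lemma IsHarmonicSol.odd_eq {n k : ℕ} (hn : 2 ≤ n) {u : ℕ → ℝ} (hu : IsHarmonicSol n k u)
    {i : ℕ} (hi : 1 ≤ i) (hik : i < k) :
    (k : ℝ) * (n - 1) * u (2 * i - 1) = u (2 * i) + (k - i) * u (2 * i + 1) +
      (i - 1) * (n - 1) * u (2 * i - 3) + (k - i + 1) * (n - 2) * u (2 * i - 1) := by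
  have hk0 : (k : ℝ) ≠ 0 := by norm_cast; omega
  have hn0 : (n : ℝ) - 1 ≠ 0 := by
    have : (2 : ℝ) ≤ n := by exact_mod_cast hn
    linarith
  have hmod : (2 * i - 1) % 2 = 1 := by omega
  have hdiv : (2 * i - 1 + 1) / 2 = i := by omega
  have h1 : lumpedQ n k (2 * i - 1) (2 * i) = 1 / (k * (n - 1)) := by
    simp [lumpedQ, hmod, hdiv]
  have h2 : lumpedQ n k (2 * i - 1) (2 * i - 3) = (i - 1) / k := by
    simp [lumpedQ, hmod, hdiv, show 2 * i - 3 ≠ 2 * i by omega,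
      show 2 * i - 3 ≠ 2 * i + 1 by omega]
  have h3 : lumpedQ n k (2 * i - 1) (2 * i + 1) = (k - i) / (k * (n - 1)) := by
    simp [lumpedQ, hmod, hdiv]
  have h4 : lumpedQ n k (2 * i - 1) (2 * i - 1) = (k - i + 1) * (n - 2) / (k * (n - 1)) := by
    simp [lumpedQ, hmod, hdiv, show 2 * i - 1 ≠ 2 * i by omega,
      show 2 * i - 1 ≠ 2 * i + 1 by omega, show 2 * i - 1 ≠ 2 * i - 3 by omega]
  have h := hu.2.2 (2 * i - 1) (by omega) (by omega)
  rw [sum_mul_eq_of_support_four (a := 2 * i) (b := 2 * i - 3) (c := 2 * i + 1) (d := 2 * i - 1)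
    (by omega) (by omega) (by omega) (by omega) (by omega) (by omega)
    (by simp; omega) ?_ (by simp; omega) (by simp; omega) ?_, h1, h2, h3, h4] at h
  · field_simp at h
    linarith
  · rcases hi.eq_or_lt with rfl | hi
    · right; rw [h2]; simp
    · left; simp; omega
  · intro m _ ha hb hc hd
    simp [lumpedQ, hmod, hdiv, ha, hb, hc, hd]

/-- The quantity `u(2i) + (n-1) u(2i-1)` does not depend on `i`. -/
lemma IsHarmonicSol.even_add_odd_succ {n k : ℕ} (hn : 2 ≤ n) {u : ℕ → ℝ}
    (hu : IsHarmonicSol n k u) {j : ℕ} (hj : j + 1 < k) :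
    u (2 * j + 4) + (n - 1) * u (2 * j + 3) = u (2 * j + 2) + ((n : ℝ) - 1) * u (2 * j + 1) := by
  have he := hu.even_eq hn (i := j + 1) (by omega) hj
  have ho := hu.odd_eq hn (i := j + 1) (by omega) hj
  have hkj : (k : ℝ) - (j + 1) ≠ 0 := by
    have : (j : ℝ) + 1 < k := by exact_mod_cast hj
    linarith
  apply mul_left_cancel₀ hkj
  induction j with
  | zero =>
    norm_num at he ho
    simp only [Nat.cast_zero, mul_zero, zero_add]
    linear_combination -he - ((n : ℝ) - 1) * ho
  | succ j ih =>
    have hj' : (k : ℝ) - (j + 1) ≠ 0 := by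
      have : (j : ℝ) + 1 < k := by exact_mod_cast (show j + 1 < k by omega)
      linarith
    have hprev := mul_left_cancel₀ hj' (ih (by omega)
      (hu.even_eq hn (i := j + 1) (by omega) (by omega))
      (hu.odd_eq hn (i := j + 1) (by omega) (by omega)) hj')
    rw [show 2 * (j + 1 + 1) - 1 = 2 * j + 3 by omega] at he ho
    rw [show 2 * (j + 1 + 1) - 2 = 2 * j + 2 by omega] at he
    rw [show 2 * (j + 1 + 1) - 3 = 2 * j + 1 by omega] at ho
    simp only [mul_add, Nat.reduceMul, add_assoc, Nat.reduceAdd, mul_one] at he ho hprev ⊢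
    push_cast at he ho ⊢
    linear_combination -he - ((n : ℝ) - 1) * ho + ((n : ℝ) - 1) * (j + 1) * hprev

/-- The quantity `i u(2i) + (k-i) u(2i+1)` equals `k u(1)`. -/
lemma IsHarmonicSol.mul_apply_one {n k : ℕ} (hn : 2 ≤ n) {u : ℕ → ℝ}
    (hu : IsHarmonicSol n k u) {j : ℕ} (hj : j + 1 < k) :
    (k : ℝ) * u 1 = (j + 1) * u (2 * j + 2) + (k - (j + 1)) * u (2 * j + 3) := by
  have ho := hu.odd_eq hn (i := j + 1) (by omega) hj
  induction j with
  | zero =>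
    norm_num at ho ⊢
    linear_combination ho
  | succ j ih =>
    have hprev := ih (by omega) (hu.odd_eq hn (i := j + 1) (by omega) (by omega))
    have hconst := hu.even_add_odd_succ hn (j := j) (by omega)
    rw [show 2 * (j + 1 + 1) - 1 = 2 * j + 3 by omega,
      show 2 * (j + 1 + 1) - 3 = 2 * j + 1 by omega] at ho
    simp only [mul_add, Nat.reduceMul, add_assoc, Nat.reduceAdd, mul_one] at ho hprev hconst ⊢
    push_cast at ho ⊢
    linear_combination ho + hprev - ((j : ℝ) + 1) * hconst

theorem stmt_17 (n k : ℕ) (hn : 2 ≤ n) (hk : 2 ≤ k)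
    (u : ℕ → ℝ) (hu : IsHarmonicSol n k u) :
    ∀ i, 1 ≤ i → i ≤ k - 1 →
      u 1 = ((i : ℝ) / (k : ℝ)) * u (2 * i) +
        (((k : ℝ) - (i : ℝ)) / (k : ℝ)) * u (2 * i + 1) := by
  intro i hi hik
  obtain ⟨j, rfl⟩ := Nat.exists_eq_add_of_le' hi
  have hk0 : (k : ℝ) ≠ 0 := by norm_cast; omega
  have h := hu.mul_apply_one hn (j := j) (by omega)
  push_cast
  field_simp
  rw [mul_comm]
  exact h
end
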